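/- For every θ > 0 and h₀ > 0, ∑_{j=1}^∞ 1/(2(θ + h₀^{−2}π²j²)²) = (h₀/(8θ^{3/2})) · ((1 + 4θ^{1/2}h₀e^{−2θ^{1/2}h₀} − e^{−4θ^{1/2}h₀})/(1 − e^{−2θ^{1/2}h₀})² − 2/(θ^{1/2}h₀)). -/

import Mathlib

open Real

lemma aux_summable (s : ℕ) (hs : 1 < s) :
    Summable (fun j : ℕ => 1 / (π * ((j : ℝ) + 1)) ^ s) := by
  have h := ((summable_nat_add_iff 1).mpr (Real.summable_one_div_nat_pow.mpr hs)).mul_left (1 / π ^ s)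
  refine h.congr fun j => ?_
  push_cast
  rw [mul_pow]
  field_simp

lemma aux_compl (l : ℝ) (hl : 0 < l) :
    Complex.I * ((l / π : ℝ) : ℂ) ∈ Complex.integerComplement := by
  rintro ⟨n, hn⟩
  have := congrArg Complex.im hn
  have h0 : l / π ≠ 0 := by positivity
  simp [-Complex.ofReal_div, hl.ne'] at this
  exact h0 this.symm

lemma aux_sum (l : ℝ) (hl : 0 < l) :
    ∑' j : ℕ, 1 / (l ^ 2 + (π * ((j : ℝ) + 1)) ^ 2) =
      (1 + Real.exp (-2 * l)) / (1 - Real.exp (-2 * l)) / (2 * l) - 1 / (2 * l ^ 2) := by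
  have hq : Real.exp (-2 * l) < 1 := by rw [Real.exp_lt_one_iff]; linarith
  have h := cot_series_rep' (aux_compl l hl)
  have hpi : (π : ℂ) ≠ 0 := by exact_mod_cast Real.pi_ne_zero
  have hlc : (l : ℂ) ≠ 0 := by exact_mod_cast hl.ne'
  have e1 : ∀ n : ℕ, (1 / (Complex.I * ((l / π : ℝ) : ℂ) - (n + 1)) +
      1 / (Complex.I * ((l / π : ℝ) : ℂ) + (n + 1))) =
      (-2 * Complex.I * l * π) * ((1 / (l ^ 2 + (π * ((n : ℝ) + 1)) ^ 2) : ℝ) : ℂ) := by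
    intro n
    have h1 : Complex.I * ((l / π : ℝ) : ℂ) - (n + 1) ≠ 0 := by
      intro h
      have := congrArg Complex.im h
      simp at this
      exact hl.ne' this
    have h2 : Complex.I * ((l / π : ℝ) : ℂ) + (n + 1) ≠ 0 := by
      intro h
      have := congrArg Complex.im h
      simp at this
      exact hl.ne' this
    have h3 : ((l : ℂ) ^ 2 + (π * ((n : ℂ) + 1)) ^ 2) ≠ 0 := by
      have : (l ^ 2 + (π * ((n : ℝ) + 1)) ^ 2) ≠ 0 := by positivity
      exact_mod_cast this
    rw [div_add_div _ _ h1 h2]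
    push_cast at h1 h2 ⊢
    rw [mul_one_div, div_eq_div_iff (mul_ne_zero h1 h2) h3]
    field_simp
    ring_nf
    simp only [Complex.I_sq, show Complex.I ^ 3 = -Complex.I by rw [pow_succ, Complex.I_sq]; ring]
    ring
  simp_rw [e1] at h
  rw [tsum_mul_left, ← Complex.ofReal_tsum, Complex.cot_pi_eq_exp_ratio] at h
  have e2 : 2 * (π : ℂ) * Complex.I * (Complex.I * ((l / π : ℝ) : ℂ)) = ((-2 * l : ℝ) : ℂ) := by
    push_cast
    field_simp
    rw [Complex.I_sq]
  rw [e2, ← Complex.ofReal_exp] at h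
  set S := ∑' j : ℕ, 1 / (l ^ 2 + (π * ((j : ℝ) + 1)) ^ 2)
  set q := Real.exp (-2 * l)
  have hq1 : (1 - (q : ℂ)) ≠ 0 := by
    have : 1 - q ≠ 0 := by linarith
    exact_mod_cast this
  have : ((S : ℝ) : ℂ) = (((1 + q) / (1 - q) / (2 * l) - 1 / (2 * l ^ 2) : ℝ) : ℂ) := by
    have hne : (-2 * Complex.I * l * π) ≠ 0 := by simp [hlc, hpi]
    apply mul_left_cancel₀ hne
    rw [← h]
    push_cast
    field_simp
    simp only [Complex.I_sq]
    ring
  exact_mod_cast this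

lemma aux_deriv (t : ℝ) (ht : 0 < t) :
    HasDerivAt (fun t : ℝ => ∑' j : ℕ, 1 / (t + (π * ((j : ℝ) + 1)) ^ 2))
      (∑' j : ℕ, -(1 / (t + (π * ((j : ℝ) + 1)) ^ 2) ^ 2)) t := by
  refine hasDerivAt_tsum_of_isPreconnected (F := ℝ) (𝕜 := ℝ)
    (g := fun (j : ℕ) (t : ℝ) => 1 / (t + (π * ((j : ℝ) + 1)) ^ 2))
    (g' := fun (j : ℕ) (t : ℝ) => -(1 / (t + (π * ((j : ℝ) + 1)) ^ 2) ^ 2)) (aux_summable 4 (by norm_num)) isOpen_Ioi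
    isPreconnected_Ioi (t := Set.Ioi 0) (y₀ := t) ?_ ?_ ht ?_ ht
  · intro j y hy
    have hy : 0 < y := hy
    have h3 : y + (π * ((j : ℝ) + 1)) ^ 2 ≠ 0 := by positivity
    have := ((hasDerivAt_id y).add_const ((π * ((j : ℝ) + 1)) ^ 2)).inv h3
    rw [neg_div] at this
    simp only [one_div, id] at this ⊢
    exact this
  · intro j y hy
    have hy : 0 < y := hy
    rw [norm_neg, Real.norm_of_nonneg (by positivity)]
    apply one_div_le_one_div_of_le (by positivity)
    calc (π * ((j : ℝ) + 1)) ^ 4 = ((π * ((j : ℝ) + 1)) ^ 2) ^ 2 := by ring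
      _ ≤ _ := by gcongr; linarith
  · refine Summable.of_nonneg_of_le (fun j => by positivity) (fun j => ?_)
      (aux_summable 2 (by norm_num))
    apply one_div_le_one_div_of_le (by positivity)
    linarith

lemma aux_sum2 (l : ℝ) (hl : 0 < l) :
    HasSum (fun j : ℕ => 1 / (l ^ 2 + (π * ((j : ℝ) + 1)) ^ 2) ^ 2)
      (1 / l ^ 3 * ((1 + 4 * l * Real.exp (-2 * l) - Real.exp (-2 * l) ^ 2) /
        (4 * (1 - Real.exp (-2 * l)) ^ 2) - 1 / (2 * l))) := by
  have hsum : Summable (fun j : ℕ => 1 / (l ^ 2 + (π * ((j : ℝ) + 1)) ^ 2) ^ 2) := by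
    refine Summable.of_nonneg_of_le (fun j => by positivity) (fun j => ?_)
      (aux_summable 4 (by norm_num))
    apply one_div_le_one_div_of_le (by positivity)
    calc (π * ((j : ℝ) + 1)) ^ 4 = ((π * ((j : ℝ) + 1)) ^ 2) ^ 2 := by ring
      _ ≤ _ := by gcongr; nlinarith
  have hq : Real.exp (-2 * l) < 1 := by rw [Real.exp_lt_one_iff]; linarith
  have hq1 : 1 - Real.exp (-2 * l) ≠ 0 := by linarith
  have d1 := (aux_deriv (l ^ 2) (by positivity)).comp l (hasDerivAt_pow 2 l)
  have dq : HasDerivAt (fun l : ℝ => Real.exp (-2 * l)) (Real.exp (-2 * l) * (-2 * 1)) l :=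
    ((hasDerivAt_id l).const_mul (-2)).exp
  have d2 := (((dq.const_add 1).div (dq.const_sub 1) hq1).div
    ((hasDerivAt_id l).const_mul 2) (by simpa using hl.ne')).sub
    ((hasDerivAt_const l (1 : ℝ)).div ((hasDerivAt_pow 2 l).const_mul 2) (by positivity))
  have d3 := d1.unique (d2.congr_of_eventuallyEq (by
    filter_upwards [lt_mem_nhds hl] with x hx
    simpa using aux_sum x hx))
  rw [tsum_neg] at d3
  rw [hsum.hasSum_iff]
  set S := ∑' j : ℕ, 1 / (l ^ 2 + (π * ((j : ℝ) + 1)) ^ 2) ^ 2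
  simp only [Pi.div_apply, id] at d3
  set q := Real.exp (-2 * l)
  have hne : -(2 * l) ≠ 0 := by simpa using hl.ne'
  apply mul_left_cancel₀ hne
  have : -(2 * l) * S = -S * (↑2 * l ^ (2 - 1)) := by norm_num; ring
  rw [this]
  refine (Eq.trans (by norm_num) d3).trans ?_
  push_cast
  field_simp
  ring

/-- Closed-form evaluation of the Fisher information
`I(θ) = ∑_{j≥1} 1/(2(θ + h₀^{−2}π²j²)²)` of the Gaussian scale product model. -/
theorem fisher_information_closed_form (θ h₀ : ℝ) (hθ : 0 < θ) (hh₀ : 0 < h₀) :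
    HasSum (fun j : ℕ => 1 / (2 * (θ + h₀ ^ (-2 : ℤ) * π ^ 2 * ((j : ℝ) + 1) ^ 2) ^ 2))
      (h₀ / (8 * Real.sqrt θ ^ 3) *
        ((1 + 4 * Real.sqrt θ * h₀ * Real.exp (-2 * Real.sqrt θ * h₀)
            - Real.exp (-4 * Real.sqrt θ * h₀)) /
          (1 - Real.exp (-2 * Real.sqrt θ * h₀)) ^ 2
          - 2 / (Real.sqrt θ * h₀))) := by
  obtain ⟨s, hs, rfl⟩ : ∃ s : ℝ, 0 < s ∧ θ = s ^ 2 :=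
    ⟨√θ, Real.sqrt_pos.mpr hθ, (Real.sq_sqrt hθ.le).symm⟩
  rw [Real.sqrt_sq hs.le]
  have hl : 0 < s * h₀ := by positivity
  have h := (aux_sum2 (s * h₀) hl).mul_left (h₀ ^ 4 / 2)
  have hq : Real.exp (-2 * (s * h₀)) < 1 := by rw [Real.exp_lt_one_iff]; linarith
  have hq1 : 1 - Real.exp (-2 * (s * h₀)) ≠ 0 := by linarith
  have e4 : Real.exp (-4 * s * h₀) = Real.exp (-2 * (s * h₀)) ^ 2 := by
    rw [← Real.exp_nat_mul]; congr 1; push_cast; ring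
  have e2 : -2 * s * h₀ = -2 * (s * h₀) := by ring
  rw [e4, e2]
  set q := Real.exp (-2 * (s * h₀))
  convert h using 1
  · rfl
  · funext j
    have : s ^ 2 + h₀ ^ (-2 : ℤ) * π ^ 2 * ((j : ℝ) + 1) ^ 2 =
        ((s * h₀) ^ 2 + (π * ((j : ℝ) + 1)) ^ 2) / h₀ ^ 2 := by
      rw [zpow_neg]
      norm_cast
      field_simp
      push_cast
      ring
    rw [this]
    field_simp
  · field_simp
    ring
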